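/- Suppose the sequences u^n, p^n, η^n, s^n satisfy equations (Step 1) and (Step 2) of the scheme for every n ≥ 1. Then the scheme is unconditionally energy stable: for every n ≥ 1, E₀(n) + Σ_{m=1}^{n} τ·E₁(m) ≤ E₀(0). In particular ‖u^n‖, ‖η^n‖_s, ‖σ^n‖_Σ and ‖γu^n‖_Σ are bounded in terms of the initial energy E₀(0), uniformly in n and in all the parameters. -/

import Mathlib

open scoped RealInnerProductSpace

theorem inner_sub_self_eq_half {E : Type*} [NormedAddCommGroup E] [InnerProductSpace ℝ E]
    (x y : E) : ⟪x - y, x⟫ = (‖x‖ ^ 2 - ‖y‖ ^ 2 + ‖x - y‖ ^ 2) / 2 := by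
  rw [norm_sub_sq_real, inner_sub_left, real_inner_self_eq_norm_sq, real_inner_comm]
  ring

/-- A weighted Young inequality whose two weights have product one. -/
theorem weighted_young_inner {E : Type*} [NormedAddCommGroup E] [InnerProductSpace ℝ E]
    {c k l : ℝ} (hc : 0 < c) (hk : 0 < k) (hkl : k * l = 1) (τ : ℝ) (x y : E) :
    0 ≤ c / 2 * k * ‖x‖ ^ 2 + τ * ⟪y, x⟫ + τ ^ 2 / (2 * c) * l * ‖y‖ ^ 2 := by
  have h : 0 ≤ c / (2 * k) * ‖k • x + (τ / c) • y‖ ^ 2 := by positivity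
  rw [norm_add_sq_real, norm_smul, norm_smul, mul_pow, mul_pow, Real.norm_eq_abs,
    Real.norm_eq_abs, sq_abs, sq_abs, real_inner_smul_left, real_inner_smul_right,
    real_inner_comm] at h
  obtain rfl : l = k⁻¹ := eq_inv_of_mul_eq_one_right hkl
  refine h.trans_eq ?_
  field_simp

/-- The weights `1 - β₀` and `1 + β - β₀` are positive reciprocals, and `β₀ ≥ 0`. -/
theorem stabilization_weights {β β₀ : ℝ} (hβ : 0 ≤ β)
    (hβ₀ : β₀ = 1 - (Real.sqrt (4 + β ^ 2) - β) / 2) :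
    0 < 1 - β₀ ∧ (1 - β₀) * (1 + β - β₀) = 1 ∧ 0 ≤ β₀ := by
  have hsq : Real.sqrt (4 + β ^ 2) ^ 2 = 4 + β ^ 2 := Real.sq_sqrt (by positivity)
  have hlt : β < Real.sqrt (4 + β ^ 2) := Real.lt_sqrt_of_sq_lt (by linarith)
  have hle : Real.sqrt (4 + β ^ 2) ≤ 2 + β := Real.sqrt_le_iff.2 ⟨by linarith, by nlinarith⟩
  subst hβ₀
  exact ⟨by linarith, by linear_combination hsq / 4, by linarith⟩

/-- Energy decay over one time step, for the two tested equations of the scheme. -/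
theorem energy_step {V S : Type*}
    [NormedAddCommGroup V] [InnerProductSpace ℝ V]
    [NormedAddCommGroup S] [InnerProductSpace ℝ S]
    (aS : S →ₗ[ℝ] S →ₗ[ℝ] ℝ) (haS_symm : ∀ v w, aS v w = aS w v)
    {ρf ρs εs τ β β₀ A : ℝ} (hρs : 0 < ρs) (hεs : 0 < εs) (hτ : 0 < τ)
    (hk : 0 < 1 - β₀) (hkl : (1 - β₀) * (1 + β - β₀) = 1)
    {u u' : V} {η η' s g g' σ σ' : S}
    (h_struct : ρs * εs * ⟪τ⁻¹ • (s - g'), s⟫ + aS η s = -⟪σ', s⟫)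
    (hη : η = η' + τ • s)
    (h_fluid : ρf * ⟪τ⁻¹ • (u - u'), u⟫ + A - ⟪σ, g⟫
        + ρs * εs * ⟪τ⁻¹ • (g - s), g + (τ / (ρs * εs)) • σ⟫
        + ⟪σ - σ', g + (τ * (1 + β) / (ρs * εs)) • σ⟫ = 0) :
    (ρf / 2 * ‖u‖ ^ 2 + 1 / 2 * aS η η + τ ^ 2 * (1 + β) / (2 * ρs * εs) * ‖σ‖ ^ 2
        + ρs * εs / 2 * ‖g‖ ^ 2)
      + τ * (A + ρf / (2 * τ) * ‖u - u'‖ ^ 2 + ρs * εs / (2 * τ) * ‖s - g'‖ ^ 2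
        + ρs * εs * β₀ / (2 * τ) * ‖s - g‖ ^ 2 + τ * β₀ / (2 * ρs * εs) * ‖σ - σ'‖ ^ 2
        + τ / 2 * aS s s)
      ≤ ρf / 2 * ‖u'‖ ^ 2 + 1 / 2 * aS η' η' + τ ^ 2 * (1 + β) / (2 * ρs * εs) * ‖σ'‖ ^ 2
        + ρs * εs / 2 * ‖g'‖ ^ 2 := by
  have young := weighted_young_inner (mul_pos hρs hεs) hk hkl τ (g - s) (σ - σ')
  have h_cross : ⟪σ - σ', g - s⟫ = ⟪σ - σ', g⟫ + ⟪g - s, σ⟫ - ⟪σ, g⟫ + ⟪σ', s⟫ := by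
    rw [inner_sub_right, inner_sub_left, inner_sub_left, inner_sub_left,
      real_inner_comm σ g, real_inner_comm σ s]
    ring
  have h_aS : aS η η = aS η' η' + 2 * τ * aS η s - τ ^ 2 * aS s s := by
    subst hη
    simp only [map_add, map_smul, LinearMap.add_apply, LinearMap.smul_apply, smul_eq_mul,
      haS_symm s η']
    ring
  rw [h_cross] at young
  rw [h_aS, norm_sub_rev s g]
  simp only [inner_add_right, real_inner_smul_left, real_inner_smul_right,
    inner_sub_self_eq_half] at h_struct h_fluid
  rw [← sub_nonneg]
  refine young.trans_eq ?_
  linear_combination (norm := (field_simp; ring)) τ * (h_struct + h_fluid)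

/-- unconditional energy stability
`E₀(n) + Σ_{m=1}^{n} τ·E₁(m) ≤ E₀(0)`, and in particular boundedness of
`‖uⁿ‖`, `‖ηⁿ‖_s`, `‖σⁿ‖_Σ`, `‖γuⁿ‖_Σ` in terms of the initial energy,
for the fully discrete kinematically coupled scheme, in an abstract
inner-product-space setting.  Here `γ` abstracts the boundary trace,
`aF` the fluid form `2μ(D(u),D(v))`, `aS` the structure form, `b` the
pressure/divergence form and `B` the boundary stress `(σ(v,q)·n)|_Σ`;
`σⁿ = B(uⁿ, pⁿ)`. -/
theorem stmt_2
    {V Q S : Type*}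
    [NormedAddCommGroup V] [InnerProductSpace ℝ V]
    [AddCommGroup Q] [Module ℝ Q]
    [NormedAddCommGroup S] [InnerProductSpace ℝ S]
    (γ : V →ₗ[ℝ] S)
    (aF : V →ₗ[ℝ] V →ₗ[ℝ] ℝ) (haF_symm : ∀ v w, aF v w = aF w v)
    (haF_pos : ∀ v, 0 ≤ aF v v)
    (aS : S →ₗ[ℝ] S →ₗ[ℝ] ℝ) (haS_symm : ∀ v w, aS v w = aS w v)
    (haS_pos : ∀ v, 0 ≤ aS v v)
    (b : Q →ₗ[ℝ] V →ₗ[ℝ] ℝ)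
    (B : V →ₗ[ℝ] Q →ₗ[ℝ] S)
    (ρf ρs εs τ : ℝ) (hρf : 0 < ρf) (hρs : 0 < ρs) (hεs : 0 < εs) (hτ : 0 < τ)
    (β : ℝ) (hβ : 0 ≤ β)
    (β₀ : ℝ) (hβ₀ : β₀ = 1 - (Real.sqrt (4 + β ^ 2) - β) / 2)
    (u : ℕ → V) (p : ℕ → Q) (η : ℕ → S) (s : ℕ → S)
    -- Step 1 of the scheme
    (step1 : ∀ n, 1 ≤ n →
      (∀ w : S,
        ρs * εs * ⟪τ⁻¹ • (s n - γ (u (n - 1))), w⟫ + aS (η n) w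
          = -⟪B (u (n - 1)) (p (n - 1)), w⟫) ∧
      η n = η (n - 1) + τ • s n)
    -- Step 2 of the scheme
    (step2 : ∀ n, 1 ≤ n → ∀ (v : V) (q : Q),
      ρf * ⟪τ⁻¹ • (u n - u (n - 1)), v⟫ + aF (u n) v - b (p n) v + b q (u n)
        - ⟪B (u n) (p n), γ v⟫
        + ρs * εs * ⟪τ⁻¹ • (γ (u n) - s n), γ v + (τ / (ρs * εs)) • B v q⟫
        + ⟪B (u n) (p n) - B (u (n - 1)) (p (n - 1)),
            γ v + (τ * (1 + β) / (ρs * εs)) • B v q⟫ = 0)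
    -- the energies
    (E₀ E₁ : ℕ → ℝ)
    (hE₀ : ∀ n, E₀ n =
      ρf / 2 * ‖u n‖ ^ 2 + 1 / 2 * aS (η n) (η n)
        + τ ^ 2 * (1 + β) / (2 * ρs * εs) * ‖B (u n) (p n)‖ ^ 2
        + ρs * εs / 2 * ‖γ (u n)‖ ^ 2)
    (hE₁ : ∀ n, 1 ≤ n → E₁ n =
      aF (u n) (u n)
        + ρf / (2 * τ) * ‖u n - u (n - 1)‖ ^ 2
        + ρs * εs / (2 * τ) * ‖s n - γ (u (n - 1))‖ ^ 2
        + ρs * εs * β₀ / (2 * τ) * ‖s n - γ (u n)‖ ^ 2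
        + τ * β₀ / (2 * ρs * εs) * ‖B (u n) (p n) - B (u (n - 1)) (p (n - 1))‖ ^ 2
        + τ / 2 * aS (s n) (s n)) :
    ∀ n, 1 ≤ n →
      E₀ n + (∑ m ∈ Finset.Icc 1 n, τ * E₁ m) ≤ E₀ 0 ∧
      ρf / 2 * ‖u n‖ ^ 2 ≤ E₀ 0 ∧
      1 / 2 * aS (η n) (η n) ≤ E₀ 0 ∧
      τ ^ 2 * (1 + β) / (2 * ρs * εs) * ‖B (u n) (p n)‖ ^ 2 ≤ E₀ 0 ∧
      ρs * εs / 2 * ‖γ (u n)‖ ^ 2 ≤ E₀ 0 := by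
  obtain ⟨hk, hkl, hβ₀_nonneg⟩ := stabilization_weights hβ hβ₀
  have h_step : ∀ n, E₀ (n + 1) + τ * E₁ (n + 1) ≤ E₀ n := by
    intro n
    have hn : 1 ≤ n + 1 := n.succ_pos
    obtain ⟨h_struct, hη⟩ := step1 (n + 1) hn
    have h_fluid := step2 (n + 1) hn (u (n + 1)) (p (n + 1))
    rw [sub_add_cancel] at h_fluid
    rw [hE₀, hE₁ (n + 1) hn, hE₀]
    exact energy_step aS haS_symm hρs hεs hτ hk hkl (h_struct (s (n + 1))) hη h_fluid
  have h_stable : ∀ n, E₀ n + ∑ m ∈ Finset.Icc 1 n, τ * E₁ m ≤ E₀ 0 := by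
    intro n
    induction n with
    | zero => simp
    | succ n ih =>
      rw [Finset.sum_Icc_succ_top n.succ_pos]
      linarith [h_step n]
  intro n _
  have h_sum : 0 ≤ ∑ m ∈ Finset.Icc 1 n, τ * E₁ m := by
    refine Finset.sum_nonneg fun m hm => mul_nonneg hτ.le ?_
    rw [hE₁ m (Finset.mem_Icc.1 hm).1]
    have h_aF := haF_pos (u m)
    have h_aS := haS_pos (s m)
    positivity
  have h_energy : E₀ n ≤ E₀ 0 := by linarith [h_stable n]
  have h_u : 0 ≤ ρf / 2 * ‖u n‖ ^ 2 := by positivity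
  have h_η : 0 ≤ 1 / 2 * aS (η n) (η n) := mul_nonneg (by norm_num) (haS_pos _)
  have h_σ : 0 ≤ τ ^ 2 * (1 + β) / (2 * ρs * εs) * ‖B (u n) (p n)‖ ^ 2 := by positivity
  have h_γ : 0 ≤ ρs * εs / 2 * ‖γ (u n)‖ ^ 2 := by positivity
  have h_split := hE₀ n
  exact ⟨h_stable n, by linarith, by linarith, by linarith, by linarith⟩
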